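/- Let T > 0, β ∈ (0,1], γ ∈ (0,1], A, B ≥ 0, and let f : [0,T]×[0,1] → ℝ be continuous. Assume (i) |f(t,x) − f(t,y)| ≤ A·|x−y|^β for all t ∈ [0,T] and x, y ∈ [0,1], and (ii) ( ∫₀¹ (f(t,x) − f(s,x))² dx )^{1/2} ≤ B·|t−s|^γ for all s, t ∈ [0,T]. Then for all s, t ∈ [0,T] with |t−s| ≤ 1 and every x ∈ [0,1], |f(t,x) − f(s,x)| ≤ (2A + B)·|t−s|^{2γβ/(2β+1)}. (Pointwise time-Hölder regularity by interpolation of spatial Hölder and L²-in-space time-Hölder bounds.) -/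

import Mathlib

open MeasureTheory

/-- A continuous function on `[0,1]` whose oscillation at scale `δ` is at most `K` exceeds `K` in
absolute value by at most its `L²` norm divided by `√δ`. -/
lemma mul_sq_abs_sub_le_integral_sq {g : ℝ → ℝ} (hg : ContinuousOn g (Set.Icc 0 1))
    {δ K : ℝ} (hδ0 : 0 < δ) (hδ1 : δ ≤ 1)
    (hK : ∀ x ∈ Set.Icc (0 : ℝ) 1, ∀ y ∈ Set.Icc (0 : ℝ) 1, |x - y| ≤ δ → |g x - g y| ≤ K)
    {x : ℝ} (hx : x ∈ Set.Icc (0 : ℝ) 1) (hKx : K ≤ |g x|) :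
    δ * (|g x| - K) ^ 2 ≤ ∫ y in (0 : ℝ)..1, g y ^ 2 := by
  obtain ⟨a, ha0, hax, hxa, ha1⟩ : ∃ a : ℝ, 0 ≤ a ∧ a ≤ x ∧ x ≤ a + δ ∧ a + δ ≤ 1 := by
    rcases le_total x (1 - δ) with h | h
    · exact ⟨x, hx.1, le_rfl, by linarith, by linarith⟩
    · exact ⟨1 - δ, by linarith, h, by linarith [hx.2], by linarith⟩
  have hsub : Set.Icc a (a + δ) ⊆ Set.Icc (0 : ℝ) 1 := Set.Icc_subset_Icc ha0 ha1
  have hint : IntervalIntegrable (fun y => g y ^ 2) volume 0 1 :=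
    ContinuousOn.intervalIntegrable_of_Icc zero_le_one (hg.pow 2)
  have hintJ : IntervalIntegrable (fun y => g y ^ 2) volume a (a + δ) :=
    ContinuousOn.intervalIntegrable_of_Icc (by linarith) ((hg.mono hsub).pow 2)
  calc δ * (|g x| - K) ^ 2 = ∫ _ in a..(a + δ), (|g x| - K) ^ 2 := by simp
    _ ≤ ∫ y in a..(a + δ), g y ^ 2 := by
      refine intervalIntegral.integral_mono_on (by linarith) (by simp) hintJ fun y hy => ?_
      have hxy : |x - y| ≤ δ := by rw [abs_le]; constructor <;> linarith [hy.1, hy.2]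
      have h := hK x hx y (hsub hy) hxy
      have h' := abs_sub_abs_le_abs_sub (g x) (g y)
      rw [← sq_abs (g y)]
      exact pow_le_pow_left₀ (by linarith) (by linarith) 2
    _ ≤ ∫ y in (0 : ℝ)..1, g y ^ 2 :=
      intervalIntegral.integral_mono_interval ha0 (by linarith) ha1
        (Filter.Eventually.of_forall fun y => sq_nonneg (g y)) hint

/-- Pointwise time-Hölder regularity by interpolation of a spatial Hölder bound and an
`L²`-in-space time-Hölder bound: if `f : [0,T]×[0,1] → ℝ` is continuous with
`|f(t,x)-f(t,y)| ≤ A|x-y|^β` and `(∫₀¹ (f(t,x)-f(s,x))² dx)^{1/2} ≤ B|t-s|^γ`, then for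
`|t-s| ≤ 1` and `x ∈ [0,1]`, `|f(t,x)-f(s,x)| ≤ (2A+B)|t-s|^{2γβ/(2β+1)}`. -/
theorem stmt19 (T : ℝ) (hT : 0 < T) (β γ : ℝ) (hβ0 : 0 < β) (hβ1 : β ≤ 1)
    (hγ0 : 0 < γ) (hγ1 : γ ≤ 1) (A B : ℝ) (hA : 0 ≤ A) (hB : 0 ≤ B)
    (f : ℝ → ℝ → ℝ)
    (hf : ContinuousOn (fun p : ℝ × ℝ => f p.1 p.2) (Set.Icc 0 T ×ˢ Set.Icc 0 1))
    (hspace : ∀ t ∈ Set.Icc (0:ℝ) T, ∀ x ∈ Set.Icc (0:ℝ) 1, ∀ y ∈ Set.Icc (0:ℝ) 1,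
      |f t x - f t y| ≤ A * |x - y| ^ β)
    (htime : ∀ s ∈ Set.Icc (0:ℝ) T, ∀ t ∈ Set.Icc (0:ℝ) T,
      Real.sqrt (∫ x in (0:ℝ)..1, (f t x - f s x) ^ 2) ≤ B * |t - s| ^ γ) :
    ∀ s ∈ Set.Icc (0:ℝ) T, ∀ t ∈ Set.Icc (0:ℝ) T, |t - s| ≤ 1 →
      ∀ x ∈ Set.Icc (0:ℝ) 1,
        |f t x - f s x| ≤ (2 * A + B) * |t - s| ^ (2 * γ * β / (2 * β + 1)) := by
  intro s hs t ht hts x hx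
  rcases (abs_nonneg (t - s)).eq_or_lt with h0 | hD
  · obtain rfl : t = s := sub_eq_zero.mp (abs_eq_zero.mp h0.symm)
    rw [sub_self, abs_zero]
    positivity
  set D := |t - s|
  have hslice : ∀ r ∈ Set.Icc (0 : ℝ) T, ContinuousOn (f r) (Set.Icc 0 1) := fun r hr =>
    hf.comp (f := fun y : ℝ => (r, y)) (by fun_prop) fun y hy => ⟨hr, hy⟩
  have hβ : 0 < 2 * β + 1 := by linarith
  set δ := D ^ (2 * γ / (2 * β + 1)) with hδ
  have hδ0 : 0 < δ := Real.rpow_pos_of_pos hD _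
  have hδ1 : δ ≤ 1 := Real.rpow_le_one hD.le hts (by positivity)
  have hδβ : D ^ (2 * γ * β / (2 * β + 1)) = δ ^ β := by
    rw [hδ, ← Real.rpow_mul hD.le]
    congr 1
    ring
  have hDγ : (D ^ γ) ^ 2 = δ * (δ ^ β) ^ 2 := by
    rw [hδ, ← Real.rpow_mul hD.le, ← Real.rpow_mul_natCast hD.le, ← Real.rpow_mul_natCast hD.le,
      ← Real.rpow_add hD]
    congr 1
    push_cast
    field_simp
    ring
  have hδβ0 : 0 < δ ^ β := Real.rpow_pos_of_pos hδ0 β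
  rw [hδβ]
  have hosc : ∀ x ∈ Set.Icc (0 : ℝ) 1, ∀ y ∈ Set.Icc (0 : ℝ) 1, |x - y| ≤ δ →
      |(f t x - f s x) - (f t y - f s y)| ≤ 2 * A * δ ^ β := by
    intro x hx y hy hxy
    have hA' : A * |x - y| ^ β ≤ A * δ ^ β := by gcongr
    calc |(f t x - f s x) - (f t y - f s y)| = |(f t x - f t y) - (f s x - f s y)| := by
          congr 1; ring
      _ ≤ |f t x - f t y| + |f s x - f s y| := abs_sub _ _
      _ ≤ 2 * A * δ ^ β := by linarith [hspace t ht x hx y hy, hspace s hs x hx y hy]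
  rcases le_total |f t x - f s x| (2 * A * δ ^ β) with hle | hge
  · nlinarith [mul_nonneg hB hδβ0.le]
  have hlow := mul_sq_abs_sub_le_integral_sq (g := fun y => f t y - f s y)
    ((hslice t ht).sub (hslice s hs)) hδ0 hδ1 hosc hx hge
  have hup := Real.sqrt_le_iff.mp (htime s hs t ht)
  have hsq : (|f t x - f s x| - 2 * A * δ ^ β) ^ 2 ≤ (B * δ ^ β) ^ 2 := by
    refine le_of_mul_le_mul_left ((hlow.trans hup.2).trans_eq ?_) hδ0
    rw [mul_pow, mul_pow, hDγ]
    ring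
  linarith [le_of_abs_le (abs_le_of_sq_le_sq hsq (by positivity))]
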